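/- Let 0 < t < 4 and set w₀ := i·√(4/t − 1) ∈ ℂ and Θ_t := (1/2)·√(t(4−t)) + 2·arcsin(√(t/4)). Then ((w₀ − 1)/(w₀ + 1))·e^{t·w₀/2} = e^{iΘ_t}. -/

import Mathlib

noncomputable section

/-- The edge `Θ_t = (1/2)·√(t(4−t)) + 2·arcsin(√(t/4))` of the support of the spectral
measure of free unitary Brownian motion at time `t`. -/
def Theta (t : ℝ) : ℝ :=
  (1 / 2) * Real.sqrt (t * (4 - t)) + 2 * Real.arcsin (Real.sqrt (t / 4))

/-- For `0 < t < 4` and `w₀ = i·√(4/t − 1)`, one has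
`((w₀ − 1)/(w₀ + 1))·e^{t·w₀/2} = e^{iΘ_t}`: the inverse of the Cauchy transform of free
unitary Brownian motion sends `w₀` to the edge point `e^{iΘ_t}`. -/
theorem stmt_8 (t : ℝ) (ht : 0 < t) (ht4 : t < 4) :
    ((Complex.I * (Real.sqrt (4 / t - 1) : ℂ) - 1) /
        (Complex.I * (Real.sqrt (4 / t - 1) : ℂ) + 1)) *
      Complex.exp ((t : ℂ) * (Complex.I * (Real.sqrt (4 / t - 1) : ℂ)) / 2) =
    Complex.exp ((Theta t : ℂ) * Complex.I) := by
  set x := Real.sqrt (t / 4) with hx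
  set a := Real.arcsin x with ha
  set s := Real.sqrt (4 / t - 1) with hs
  have hx0 : 0 < x := Real.sqrt_pos.2 (by positivity)
  have hx2 : x ^ 2 = t / 4 := Real.sq_sqrt (by positivity)
  have hx1 : x ≤ 1 := by nlinarith
  have hsin : Real.sin a = x := Real.sin_arcsin (by linarith) hx1
  have hcos : Real.cos a = s * x := by
    rw [ha, Real.cos_arcsin, hx2, hs, hx, ← Real.sqrt_mul' _ (by positivity)]
    congr 1
    field_simp
  have hroot : Real.sqrt (t * (4 - t)) = t * s := by
    rw [show t * (4 - t) = t ^ 2 * (4 / t - 1) by field_simp,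
      Real.sqrt_mul (sq_nonneg t), Real.sqrt_sq ht.le]
  have hfrac : (Complex.I * (s : ℂ) - 1) / (Complex.I * (s : ℂ) + 1) =
      Complex.exp ((a : ℂ) * Complex.I) ^ 2 := by
    have hne : Complex.I * (s : ℂ) + 1 ≠ 0 := by
      intro h
      simpa using congrArg Complex.re h
    have hunit : (s : ℂ) ^ 2 * x ^ 2 + x ^ 2 = 1 := by
      have h := Real.sin_sq_add_cos_sq a
      rw [hsin, hcos] at h
      exact_mod_cast (by linarith : s ^ 2 * x ^ 2 + x ^ 2 = 1)
    rw [div_eq_iff hne, Complex.exp_mul_I, ← Complex.ofReal_cos, ← Complex.ofReal_sin,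
      hsin, hcos]
    push_cast
    linear_combination (1 - Complex.I * (s : ℂ)) * hunit +
      -(Complex.I * s * x ^ 2 + 2 * s ^ 2 * x ^ 2 + x ^ 2) * Complex.I_sq
  rw [hfrac, ← Complex.exp_nat_mul, ← Complex.exp_add, Theta, hroot, ← hx, ← ha]
  congr 1
  push_cast
  ring

end
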